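/- For every integer r ≥ 3, there exists a primitive element α of GF(2^{2r}) and a natural number ℓ with ℓ ≡ 0 (mod 3) such that α^ℓ = 1 + α. -/

import Mathlib

lemma aux_omega (r : ℕ) (hr : 3 ≤ r) : (2 ^ (2 * r) - 1).primeFactors.card < r := by
  by_contra! hk
  set n := 2 ^ (2 * r) - 1 with hn
  have h4 : 2 ^ (2 * r) = 4 ^ r := by rw [pow_mul]; norm_num
  have h4' : 4 ^ 3 ≤ 4 ^ r := Nat.pow_le_pow_right (by norm_num) hr
  have hn0 : n ≠ 0 := by omega
  have h3 : 3 ∣ n := by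
    have := Nat.sub_dvd_pow_sub_pow 4 1 r
    simp only [one_pow] at this
    rw [hn, h4]; exact this
  have hmem : 3 ∈ n.primeFactors := Nat.mem_primeFactors.2 ⟨by norm_num, h3, hn0⟩
  have hprod : ∏ p ∈ n.primeFactors, p ≤ n :=
    Nat.le_of_dvd (Nat.pos_of_ne_zero hn0) (Nat.prod_primeFactors_dvd n)
  rw [← Finset.mul_prod_erase _ _ hmem] at hprod
  have h5 : 5 ^ (n.primeFactors.card - 1) ≤ ∏ p ∈ n.primeFactors.erase 3, p := by
    rw [← Finset.card_erase_of_mem hmem]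
    apply Finset.pow_card_le_prod
    intro p hp
    rw [Finset.mem_erase] at hp
    have hpp := Nat.prime_of_mem_primeFactors hp.2
    have hpd := Nat.dvd_of_mem_primeFactors hp.2
    have h2 : p ≠ 2 := by
      rintro rfl
      have : 2 ∣ 4 ^ r := dvd_pow (by norm_num) (by omega)
      omega
    have h4 : p ≠ 4 := by rintro rfl; norm_num at hpp
    have := hpp.two_le
    omega
  obtain ⟨s, rfl⟩ := Nat.exists_eq_add_of_le hr
  have h6 : 5 ^ (2 + s) ≤ 5 ^ (n.primeFactors.card - 1) :=
    Nat.pow_le_pow_right (by norm_num) (by omega)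
  have h7 : 4 ^ s ≤ 5 ^ s := Nat.pow_le_pow_left (by norm_num) s
  rw [pow_add] at h6 h4
  omega

section
variable {F : Type*} [Field F] [Fintype F]

lemma aux_norm (χ : MulChar F ℂ) (x : F) : ‖χ x‖ ≤ 1 := by
  by_cases hx : x = 0
  · subst hx; rw [MulChar.map_zero, norm_zero]; exact zero_le_one
  · have h : χ x ^ (Fintype.card F - 1) = 1 := by
      rw [← map_pow, FiniteField.pow_card_sub_one_eq_one x hx, map_one]
    have hc : Fintype.card F - 1 ≠ 0 := by have := Fintype.one_lt_card (α := F); omega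
    exact (Complex.norm_eq_one_of_pow_eq_one h hc).le

lemma aux_jacobi (h2 : ringChar F = 2) (χ φ : MulChar F ℂ) (hφ : φ ≠ 1) :
    ‖jacobiSum χ φ‖ ≤ Real.sqrt (Fintype.card F) := by
  have h1 : (1 : ℝ) ≤ Real.sqrt (Fintype.card F) := by
    rw [Real.one_le_sqrt]
    exact_mod_cast (Fintype.one_lt_card (α := F)).le
  by_cases hχ : χ = 1
  · subst hχ
    rw [jacobiSum_one_nontrivial hφ]; simpa using h1
  by_cases hm : χ * φ = 1
  · have : φ = χ⁻¹ := eq_inv_of_mul_eq_one_right hm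
    rw [this, jacobiSum_nontrivial_inv hχ, norm_neg]
    exact (aux_norm _ _).trans h1
  · have h := jacobiSum_mul_jacobiSum_inv (F' := ℂ) (by
      rw [h2, ringChar.eq_zero]; norm_num) hχ hφ hm
    have hs : jacobiSum χ⁻¹ φ⁻¹ = star (jacobiSum χ φ) := by
      simp only [jacobiSum, star_sum, star_mul', MulChar.star_apply']
    rw [hs] at h
    apply Real.le_sqrt_of_sq_le
    have := congrArg norm h
    rw [norm_mul, norm_star] at this
    rw [sq, this]; simp

noncomputable def auxG (χ : MulChar F ℂ) (p : ℕ) (x : F) : ℂ :=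
  (1 - (p : ℂ)⁻¹) - (p : ℂ)⁻¹ * ∑ j ∈ Finset.range (p - 1), (χ ^ (j + 1)) x

lemma auxG_one (χ : MulChar F ℂ) (p : ℕ) (hp : 0 < p) (x : F) (h : χ x = 1) : auxG χ p x = 0 := by
  have : (p : ℂ) ≠ 0 := by exact_mod_cast hp.ne'
  simp only [auxG, MulChar.pow_apply' _ (Nat.succ_ne_zero _), h, one_pow, Finset.sum_const,
    Finset.card_range, nsmul_eq_mul, mul_one]
  rw [Nat.cast_sub hp]; push_cast
  field_simp
  ring

lemma auxG_ne (χ : MulChar F ℂ) (p : ℕ) (hp : 0 < p) (hχ : χ ^ p = 1) (x : F) (hx : x ≠ 0)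
    (h : χ x ≠ 1) : auxG χ p x = 1 := by
  have hp0 : (p : ℂ) ≠ 0 := by exact_mod_cast hp.ne'
  have h1 : χ x ^ p = 1 := by
    rw [← MulChar.pow_apply' _ hp.ne', hχ, MulChar.one_apply hx.isUnit]
  have h2 : ∑ j ∈ Finset.range p, χ x ^ j = 0 := by
    rw [geom_sum_eq h, h1]; simp
  obtain ⟨m, rfl⟩ := Nat.exists_eq_add_of_le' hp
  rw [Finset.sum_range_succ'] at h2
  simp only [auxG, MulChar.pow_apply' _ (Nat.succ_ne_zero _), Nat.add_sub_cancel]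
  rw [eq_neg_of_add_eq_zero_left h2]
  simp

lemma aux_step (f : F → ℂ) (B : ℝ) (hf : ∀ χ : MulChar F ℂ, ‖∑ x, χ x * f x‖ ≤ B)
    (ψ : MulChar F ℂ) (p : ℕ) (hp : 0 < p) (χ : MulChar F ℂ) :
    ‖∑ x, χ x * (auxG ψ p x * f x)‖ ≤ 2 * (1 - (p : ℝ)⁻¹) * B := by
  have hp0 : (p : ℝ) ≠ 0 := by exact_mod_cast hp.ne'
  have key : ∑ x, χ x * (auxG ψ p x * f x) = ((1 - (p : ℝ)⁻¹ : ℝ) : ℂ) * ∑ x, χ x * f x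
      - (p : ℂ)⁻¹ * ∑ j ∈ Finset.range (p - 1), ∑ x, (χ * ψ ^ (j + 1)) x * f x := by
    rw [Finset.sum_comm, Finset.mul_sum, Finset.mul_sum, ← Finset.sum_sub_distrib]
    refine Finset.sum_congr rfl fun x _ => ?_
    simp only [auxG, MulChar.mul_apply]
    rw [← Finset.sum_mul, ← Finset.mul_sum]
    push_cast
    ring
  have h1 : (p : ℝ)⁻¹ ≤ 1 := inv_le_one_of_one_le₀ (by exact_mod_cast hp)
  rw [key]
  refine (norm_sub_le _ _).trans ?_
  rw [norm_mul, norm_mul, Complex.norm_real, Real.norm_of_nonneg (by linarith), norm_inv,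
    Complex.norm_natCast]
  have h2 : ‖∑ j ∈ Finset.range (p - 1), ∑ x, (χ * ψ ^ (j + 1)) x * f x‖ ≤ (p - 1 : ℝ) * B := by
    refine (norm_sum_le_of_le _ (fun j _ => hf (χ * ψ ^ (j + 1)))).trans ?_
    rw [Finset.sum_const, Finset.card_range, nsmul_eq_mul, Nat.cast_sub hp, Nat.cast_one]
  calc _ ≤ (1 - (p : ℝ)⁻¹) * B + (p : ℝ)⁻¹ * ((p - 1 : ℝ) * B) := by
        gcongr
        exact hf χ
    _ = _ := by field_simp; ring

lemma aux_prod (f : F → ℂ) (B : ℝ) (hf : ∀ χ : MulChar F ℂ, ‖∑ x, χ x * f x‖ ≤ B)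
    (X : ℕ → MulChar F ℂ) (S : Finset ℕ) (hS : ∀ p ∈ S, 0 < p) : ∀ χ : MulChar F ℂ,
    ‖∑ x, χ x * ((∏ p ∈ S, auxG (X p) p x) * f x)‖ ≤ (∏ p ∈ S, (2 * (1 - (p : ℝ)⁻¹))) * B := by
  induction S using Finset.induction_on with
  | empty => simpa using hf
  | insert a S ha ih =>
    intro χ
    have := aux_step _ _ (ih fun p hp => hS p (Finset.mem_insert_of_mem hp)) (X a) a
      (hS a (Finset.mem_insert_self _ _)) χ
    simp only [Finset.prod_insert ha, mul_assoc] at this ⊢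
    exact this

lemma aux_ne_one_of_prim (χ : MulChar F ℂ) (hχ : χ ≠ 1) (α : F)
    (hα : IsPrimitiveRoot α (Fintype.card F - 1)) : χ α ≠ 1 := by
  intro h
  apply hχ
  ext u
  have hc : Fintype.card F - 1 ≠ 0 := by have := Fintype.one_lt_card (α := F); omega
  haveI : NeZero (Fintype.card F - 1) := ⟨hc⟩
  obtain ⟨i, -, hi⟩ := hα.eq_pow_of_pow_eq_one
    (FiniteField.pow_card_sub_one_eq_one (u : F) u.ne_zero)
  rw [← hi, map_pow, h, one_pow, hi, MulChar.one_apply_coe]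

lemma aux_ind (X : ℕ → MulChar F ℂ)
    (hX : ∀ p ∈ (Fintype.card F - 1).primeFactors, orderOf (X p) = p) (x : F) (hx : x ≠ 0)
    [Decidable (IsPrimitiveRoot x (Fintype.card F - 1))] :
    ∏ p ∈ (Fintype.card F - 1).primeFactors, auxG (X p) p x =
      if IsPrimitiveRoot x (Fintype.card F - 1) then 1 else 0 := by
  have hc : Fintype.card F - 1 ≠ 0 := by have := Fintype.one_lt_card (α := F); omega
  split_ifs with h
  · refine Finset.prod_eq_one fun p hp => ?_
    have hpp := Nat.prime_of_mem_primeFactors hp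
    have ho := hX p hp
    refine auxG_ne _ _ hpp.pos (by rw [← orderOf_dvd_iff_pow_eq_one, ho]) x hx ?_
    refine aux_ne_one_of_prim _ ?_ _ h
    intro h1
    rw [h1, orderOf_one] at ho
    exact hpp.one_lt.ne ho
  · have : ∃ p, p.Prime ∧ p ∣ Fintype.card F - 1 ∧ x ^ ((Fintype.card F - 1) / p) = 1 := by
      by_contra! hcon
      have := orderOf_eq_of_pow_and_pow_div_prime (Nat.pos_of_ne_zero hc)
        (FiniteField.pow_card_sub_one_eq_one x hx) hcon
      exact h (this ▸ IsPrimitiveRoot.orderOf x)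
    obtain ⟨p, hpp, hpd, hpx⟩ := this
    have hp : p ∈ (Fintype.card F - 1).primeFactors := Nat.mem_primeFactors.2 ⟨hpp, hpd, hc⟩
    refine Finset.prod_eq_zero hp (auxG_one _ _ hpp.pos _ ?_)
    obtain ⟨g, hg⟩ := IsCyclic.exists_generator (α := Fˣ)
    obtain ⟨k, hk⟩ := Submonoid.mem_powers_iff _ _ |>.1
      (mem_powers_iff_mem_zpowers.2 (hg (Units.mk0 x hx)))
    have hgo : orderOf g = Fintype.card F - 1 := by
      classical
      rw [orderOf_eq_card_of_forall_mem_zpowers hg, Nat.card_eq_fintype_card, Fintype.card_units]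
    have hk' : (g : F) ^ k = x := by
      have := congrArg Units.val hk
      simpa using this
    have h1 : g ^ (k * ((Fintype.card F - 1) / p)) = 1 := by
      ext
      push_cast
      rw [pow_mul, hk', hpx]
    rw [← orderOf_dvd_iff_pow_eq_one, hgo] at h1
    obtain ⟨m, hm⟩ := hpd
    have hm0 : 0 < m := by
      rcases Nat.eq_zero_or_pos m with rfl | h
      · simp at hm; omega
      · exact h
    rw [hm, Nat.mul_div_cancel_left _ hpp.pos] at h1
    obtain ⟨t, ht⟩ := Nat.dvd_of_mul_dvd_mul_right hm0 h1
    rw [← hk', ht, mul_comm p t, pow_mul, map_pow, ← MulChar.pow_apply' _ hpp.ne_zero]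
    have : X p ^ p = 1 := by rw [← orderOf_dvd_iff_pow_eq_one, hX p hp]
    rw [this, MulChar.one_apply (by exact (g ^ t).isUnit)]

lemma aux_main (r : ℕ) (hr : 3 ≤ r) (h2 : ringChar F = 2) (hF : Fintype.card F = 2 ^ (2 * r))
    (η : MulChar F ℂ) (hη : η ≠ 1) :
    ∃ α : F, IsPrimitiveRoot α (Fintype.card F - 1) ∧ η α * η (1 - α) ≠ 1 := by
  classical
  by_contra! hcon
  have hX : ∀ p : ℕ, ∃ χ : MulChar F ℂ, p ∈ (Fintype.card F - 1).primeFactors → orderOf χ = p := by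
    intro p
    by_cases hp : p ∈ (Fintype.card F - 1).primeFactors
    · obtain ⟨χ, hχ⟩ := MulChar.exists_mulChar_orderOf F (Nat.dvd_of_mem_primeFactors hp)
        (Complex.isPrimitiveRoot_exp p (Nat.prime_of_mem_primeFactors hp).ne_zero)
      exact ⟨χ, fun _ => hχ⟩
    · exact ⟨1, fun h => absurd h hp⟩
  choose X hX using hX
  have hb := aux_prod (fun x => η x * η (1 - x)) (Real.sqrt (Fintype.card F)) (by
    intro χ
    have := aux_jacobi h2 (χ * η) η hη
    simpa only [jacobiSum, MulChar.mul_apply, mul_assoc] using this) X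
    (Fintype.card F - 1).primeFactors (fun p hp => (Nat.prime_of_mem_primeFactors hp).pos) 1
  have hc : 1 < Fintype.card F := Fintype.one_lt_card
  have hn0 : 0 < Fintype.card F - 1 := by omega
  have hsum : ∑ x, (1 : MulChar F ℂ) x * ((∏ p ∈ (Fintype.card F - 1).primeFactors,
      auxG (X p) p x) * (η x * η (1 - x))) = (Nat.totient (Fintype.card F - 1) : ℂ) := by
    have hterm : ∀ x : F, (1 : MulChar F ℂ) x * ((∏ p ∈ (Fintype.card F - 1).primeFactors,
      auxG (X p) p x) * (η x * η (1 - x))) =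
        if x ∈ primitiveRoots (Fintype.card F - 1) F then 1 else 0 := by
      intro x
      simp only [mem_primitiveRoots hn0]
      by_cases hx : x = 0
      · subst hx
        rw [if_neg]
        · rw [MulChar.map_zero, zero_mul]
        · intro h
          exact h.ne_zero hn0.ne' rfl
      · rw [aux_ind X hX x hx, MulChar.one_apply (Ne.isUnit hx)]
        split_ifs with h
        · rw [hcon x h]; simp
        · simp
    rw [Finset.sum_congr rfl fun x _ => hterm x]
    rw [Finset.sum_ite_mem, Finset.univ_inter, Finset.sum_const, nsmul_eq_mul, mul_one]
    obtain ⟨g, hg⟩ := IsCyclic.exists_generator (α := Fˣ)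
    have hgo : orderOf g = Fintype.card F - 1 := by
      rw [orderOf_eq_card_of_forall_mem_zpowers hg, Nat.card_eq_fintype_card, Fintype.card_units]
    have hg' : IsPrimitiveRoot (g : F) (Fintype.card F - 1) := by
      rw [IsPrimitiveRoot.coe_units_iff, ← hgo]; exact IsPrimitiveRoot.orderOf g
    rw [hg'.card_primitiveRoots]
  rw [hsum, Complex.norm_natCast] at hb
  have htot : (Nat.totient (Fintype.card F - 1) : ℝ) = ((Fintype.card F - 1 : ℕ) : ℝ) *
      ∏ p ∈ (Fintype.card F - 1).primeFactors, (1 - (p : ℝ)⁻¹) := by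
    have := congrArg (Rat.cast : ℚ → ℝ) (Nat.totient_eq_mul_prod_factors (Fintype.card F - 1))
    push_cast at this
    exact_mod_cast this
  rw [htot, Finset.prod_mul_distrib, Finset.prod_const] at hb
  have hpos : 0 < ∏ p ∈ (Fintype.card F - 1).primeFactors, (1 - (p : ℝ)⁻¹) := by
    refine Finset.prod_pos fun p hp => ?_
    have : (1 : ℝ) < p := by exact_mod_cast (Nat.prime_of_mem_primeFactors hp).one_lt
    have := inv_lt_one_of_one_lt₀ this
    linarith
  have hsq : Real.sqrt (Fintype.card F) = 2 ^ r := by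
    rw [hF, mul_comm, pow_mul]; push_cast
    exact Real.sqrt_sq (by positivity)
  rw [hsq, mul_right_comm] at hb
  have hb2 := le_of_mul_le_mul_right hb hpos
  have hom := aux_omega r hr
  rw [← hF] at hom
  have hN : Fintype.card F - 1 ≤ 2 ^ (Fintype.card F - 1).primeFactors.card * 2 ^ r := by
    exact_mod_cast hb2
  have h3 : 2 ^ (Fintype.card F - 1).primeFactors.card * 2 ^ r ≤ 2 ^ (r - 1) * 2 ^ r :=
    Nat.mul_le_mul_right _ (Nat.pow_le_pow_right (by norm_num) (by omega))
  have h4 : 2 ^ (2 * r) = 2 * (2 ^ (r - 1) * 2 ^ r) := by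
    rw [← pow_add, ← pow_succ']; congr 1; omega
  have h5 : 2 ^ 1 ≤ 2 ^ (r - 1) * 2 ^ r := by
    rw [← pow_add]; exact Nat.pow_le_pow_right (by norm_num) (by omega)
  omega

lemma aux_final (r : ℕ) (hr : 3 ≤ r) [CharP F 2] (hF : Fintype.card F = 2 ^ (2 * r)) :
    ∃ α : F, IsPrimitiveRoot α (2 ^ (2 * r) - 1) ∧
      ∃ ℓ : ℕ, ℓ % 3 = 0 ∧ α ^ ℓ = 1 + α := by
  rw [← hF]
  have h3 : 3 ∣ Fintype.card F - 1 := by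
    have := Nat.sub_dvd_pow_sub_pow 4 1 r
    simp only [one_pow] at this
    rw [hF, pow_mul]; exact this
  have h64 : 2 ^ 6 ≤ Fintype.card F := by
    rw [hF]; exact Nat.pow_le_pow_right (by norm_num) (by omega)
  obtain ⟨η, ho⟩ := MulChar.exists_mulChar_orderOf F h3
    (Complex.isPrimitiveRoot_exp 3 (by norm_num))
  have hη : η ≠ 1 := by rintro rfl; simp at ho
  have hη3 : η ^ 3 = 1 := by rw [← ho]; exact pow_orderOf_eq_one η
  have hv3 : ∀ x : F, x ≠ 0 → η x ^ 3 = 1 := fun x hx => by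
    rw [← MulChar.pow_apply' _ (by norm_num), hη3, MulChar.one_apply hx.isUnit]
  haveI : NeZero (Fintype.card F - 1) := ⟨by omega⟩
  -- a primitive element with `η (1 + α) = 1` works
  have fin : ∀ α : F, IsPrimitiveRoot α (Fintype.card F - 1) → η (1 + α) = 1 →
      ∃ α : F, IsPrimitiveRoot α (Fintype.card F - 1) ∧
      ∃ ℓ : ℕ, ℓ % 3 = 0 ∧ α ^ ℓ = 1 + α := by
    intro α hα h1
    refine ⟨α, hα, ?_⟩
    have hne : 1 + α ≠ 0 := by
      intro h; rw [h, MulChar.map_zero] at h1; exact zero_ne_one h1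
    obtain ⟨i, -, hi⟩ := hα.eq_pow_of_pow_eq_one (FiniteField.pow_card_sub_one_eq_one _ hne)
    refine ⟨i, ?_, hi⟩
    have hα0 : α ≠ 0 := hα.ne_zero (by omega)
    have ho3 : orderOf (η α) = 3 :=
      orderOf_eq_prime (hv3 α hα0) (aux_ne_one_of_prim η hη α hα)
    rw [← hi, map_pow, ← orderOf_dvd_iff_pow_eq_one, ho3] at h1
    exact Nat.mod_eq_zero_of_dvd h1
  obtain ⟨α, hα, hne⟩ := aux_main r hr (ringChar.eq F 2) hF η hη
  have hα0 : α ≠ 0 := hα.ne_zero (by omega)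
  have hsub : 1 - α = 1 + α := CharTwo.sub_eq_add 1 α
  rw [hsub] at hne
  have hα1 : 1 + α ≠ 0 := by
    intro h
    have h' : α = 1 := by rw [← sub_eq_zero, CharTwo.sub_eq_add, add_comm]; exact h
    have := hα.eq_orderOf
    rw [h', orderOf_one] at this
    omega
  have ha := hv3 α hα0
  have hb := hv3 (1 + α) hα1
  have ha1 := aux_ne_one_of_prim η hη α hα
  by_cases hu : η (1 + α) = 1
  · exact fin α hα hu
  · refine fin α⁻¹ hα.inv ?_
    have : 1 + α⁻¹ = (1 + α) * α⁻¹ := by field_simp; ring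
    have hab : η (1 + α) = η α := by
      have h1 : (η α - 1) * (η α ^ 2 + η α + 1) = 0 := by linear_combination ha
      have h2 : (η (1 + α) - 1) * (η (1 + α) ^ 2 + η (1 + α) + 1) = 0 := by linear_combination hb
      have h1' := (mul_eq_zero.1 h1).resolve_left (sub_ne_zero.2 ha1)
      have h2' := (mul_eq_zero.1 h2).resolve_left (sub_ne_zero.2 hu)
      have h3 : (η (1 + α) - η α) * (η (1 + α) + η α + 1) = 0 := by
        linear_combination h2' - h1'
      rcases mul_eq_zero.1 h3 with h | h
      · exact sub_eq_zero.1 h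
      · exfalso; apply hne
        linear_combination η α * h - h1'
    rw [this, map_mul, hab, ← map_mul, mul_inv_cancel₀ hα0, map_one]

end

theorem stmt_10 (r : ℕ) (hr : 3 ≤ r) :
    ∃ α : GaloisField 2 (2 * r), IsPrimitiveRoot α (2 ^ (2 * r) - 1) ∧
      ∃ ℓ : ℕ, ℓ % 3 = 0 ∧ α ^ ℓ = 1 + α := by
  haveI : Fintype (GaloisField 2 (2 * r)) := Fintype.ofFinite _
  refine aux_final r hr ?_
  rw [← Nat.card_eq_fintype_card, GaloisField.card 2 (2 * r) (by omega)]
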